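/- Let Q : 𝕋² → 𝒮₀^{(2)} and G : 𝕋² → 𝒮₀^{(2)} be smooth, ζ > 0, L₄ ∈ ℝ, and Q₀ : 𝕋² → 𝒮₀^{(2)} smooth with ‖Q₀‖_{L^∞} small enough that C|L₄|‖Q₀‖_{L^∞} ≤ ζ/2 for the relevant interpolation constant C. If Q solves the linear elliptic-type equation ζΔQ_{ij} + 2L₄ ∂_k(∂_l Q_{ij} (Q₀)_{lk}) = −G_{ij} on 𝕋² plus lower order terms, then one has the a priori bound: testing with Q − ΔQ gives (d/dt)(‖Q‖²_{L²} + ‖∇Q‖²_{L²})/2 + (ζ/2)(‖∇Q‖²_{L²} + ‖ΔQ‖²_{L²}) ≤ C(‖Q‖²_{L²} + ‖∇Q‖²_{L²}) + C‖G‖²_{L²} for the time-dependent problem ∂_tQ_{ij} − ζΔQ_{ij} − 2L₄∂_k(∂_lQ_{ij}(Q₀)_{lk}) = G_{ij}. -/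

import Mathlib

open MeasureTheory

/-- Partial derivative in direction `i` of a function on `ℝ²`. -/
noncomputable def pd (i : Fin 2) (f : (Fin 2 → ℝ) → ℝ) : (Fin 2 → ℝ) → ℝ :=
  fun x => fderiv ℝ f x (Pi.single i 1)

/-- The fundamental cell `[0,1]²` of the torus `𝕋²`. -/
def T2 : Set (Fin 2 → ℝ) := Set.univ.pi fun _ => Set.Icc (0:ℝ) 1

/-- `f` is `1`-periodic in each coordinate direction (i.e. lives on the torus `𝕋²`). -/
def Per (f : (Fin 2 → ℝ) → ℝ) : Prop :=
  ∀ (x : Fin 2 → ℝ) (i : Fin 2), f (x + Pi.single i 1) = f x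

theorem isCompact_T2 : IsCompact T2 := isCompact_univ_pi fun _ => isCompact_Icc

theorem measurableSet_T2 : MeasurableSet T2 := isCompact_T2.isClosed.measurableSet

theorem Continuous.integrableOn_T2 {f : (Fin 2 → ℝ) → ℝ} (hf : Continuous f) :
    IntegrableOn f T2 := hf.continuousOn.integrableOn_compact isCompact_T2

theorem setIntegral_T2_eq_prod (f : (Fin 2 → ℝ) → ℝ) :
    ∫ x in T2, f x
      = ∫ p in Set.Icc (0:ℝ) 1 ×ˢ Set.Icc (0:ℝ) 1, f ![p.1, p.2] := by
  have h := (volume_preserving_finTwoArrow ℝ).symm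
  rw [← h.setIntegral_preimage_emb (MeasurableEquiv.measurableEmbedding _)]
  congr 2
  ext p
  simp [T2, Set.mem_pi, Fin.forall_fin_two, MeasurableEquiv.finTwoArrow,
    -Set.Icc_prod_Icc, -Set.pi_univ_Icc]

theorem integrableOn_unitSquare {f : ℝ × ℝ → ℝ} (hf : Continuous f) :
    IntegrableOn f (Set.Icc (0:ℝ) 1 ×ˢ Set.Icc (0:ℝ) 1) :=
  hf.continuousOn.integrableOn_compact (isCompact_Icc.prod isCompact_Icc)

theorem continuous_vec_pair : Continuous (fun p : ℝ × ℝ => (![p.1, p.2] : Fin 2 → ℝ)) := by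
  refine continuous_pi fun i => ?_
  fin_cases i
  · exact continuous_fst
  · exact continuous_snd

theorem setIntegral_T2_eq_iterated {f : (Fin 2 → ℝ) → ℝ} (hf : Continuous f) :
    ∫ x in T2, f x = ∫ a in (0:ℝ)..1, ∫ b in (0:ℝ)..1, f ![a, b] := by
  rw [setIntegral_T2_eq_prod, Measure.volume_eq_prod, setIntegral_prod]
  · simp only [intervalIntegral.integral_of_le zero_le_one, integral_Icc_eq_integral_Ioc]
  · exact integrableOn_unitSquare (hf.comp continuous_vec_pair)

theorem setIntegral_T2_eq_iterated_swap {f : (Fin 2 → ℝ) → ℝ} (hf : Continuous f) :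
    ∫ x in T2, f x = ∫ b in (0:ℝ)..1, ∫ a in (0:ℝ)..1, f ![a, b] := by
  rw [setIntegral_T2_eq_prod, Measure.volume_eq_prod, ← setIntegral_prod_swap, setIntegral_prod]
  · simp only [intervalIntegral.integral_of_le zero_le_one, integral_Icc_eq_integral_Ioc,
      Prod.fst_swap, Prod.snd_swap]
  · exact integrableOn_unitSquare ((hf.comp continuous_vec_pair).comp continuous_swap)

theorem hasDerivAt_vec_left (a b : ℝ) :
    HasDerivAt (fun s : ℝ => (![s, b] : Fin 2 → ℝ)) (Pi.single 0 1) a := by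
  rw [hasDerivAt_pi]
  intro i
  fin_cases i
  · exact hasDerivAt_id' a
  · simpa using hasDerivAt_const a b

theorem hasDerivAt_vec_right (a b : ℝ) :
    HasDerivAt (fun s : ℝ => (![a, s] : Fin 2 → ℝ)) (Pi.single 1 1) b := by
  rw [hasDerivAt_pi]
  intro i
  fin_cases i
  · simpa using hasDerivAt_const b a
  · exact hasDerivAt_id' b

theorem hasDerivAt_pd_zero {f : (Fin 2 → ℝ) → ℝ} (hf : Differentiable ℝ f) (a b : ℝ) :
    HasDerivAt (fun s => f ![s, b]) (pd 0 f ![a, b]) a :=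
  (hf _).hasFDerivAt.comp_hasDerivAt a (hasDerivAt_vec_left a b)

theorem hasDerivAt_pd_one {f : (Fin 2 → ℝ) → ℝ} (hf : Differentiable ℝ f) (a b : ℝ) :
    HasDerivAt (fun s => f ![a, s]) (pd 1 f ![a, b]) b :=
  (hf _).hasFDerivAt.comp_hasDerivAt b (hasDerivAt_vec_right a b)

theorem ContDiff.pd {n : ℕ∞} {f : (Fin 2 → ℝ) → ℝ} (hf : ContDiff ℝ (⊤ : ℕ∞) f) (k : Fin 2) :
    ContDiff ℝ n (pd k f) :=
  (hf.fderiv_right (m := n) (by exact_mod_cast le_top)).clm_apply contDiff_const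

theorem ContDiff.continuous_pd {f : (Fin 2 → ℝ) → ℝ} (hf : ContDiff ℝ 1 f) (k : Fin 2) :
    Continuous (_root_.pd k f) :=
  (hf.continuous_fderiv (by norm_num)).clm_apply continuous_const

theorem Per.pd {f : (Fin 2 → ℝ) → ℝ} (hf : Per f) (k : Fin 2) : Per (pd k f) := by
  intro x i
  have h : (fun y => f (y + Pi.single i 1)) = f := funext fun y => hf y i
  have := fderiv_comp_add_right (𝕜 := ℝ) (f := f) (x := x) (Pi.single i (1:ℝ))
  rw [h] at this
  simp only [_root_.pd, this]

theorem setIntegral_T2_pd_eq_zero {f : (Fin 2 → ℝ) → ℝ} (hf : ContDiff ℝ 1 f) (hp : Per f)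
    (k : Fin 2) : ∫ x in T2, pd k f x = 0 := by
  have hd := hf.differentiable (by norm_num)
  have hc := hf.continuous_pd k
  have h0 : ∀ b : ℝ, f ![1, b] = f ![0, b] := fun b => by
    rw [← hp ![0, b] 0]; congr 1; ext i; fin_cases i <;> simp
  have h1 : ∀ a : ℝ, f ![a, 1] = f ![a, 0] := fun a => by
    rw [← hp ![a, 0] 1]; congr 1; ext i; fin_cases i <;> simp
  fin_cases k
  · rw [setIntegral_T2_eq_iterated_swap hc]
    have : ∀ b : ℝ, ∫ a in (0:ℝ)..1, pd 0 f ![a, b] = 0 := fun b => by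
      rw [intervalIntegral.integral_eq_sub_of_hasDerivAt
        (fun a _ => hasDerivAt_pd_zero hd a b), h0, sub_self]
      exact ((hf.continuous_pd 0).comp (continuous_vec_pair.comp
        (Continuous.prodMk_left b))).intervalIntegrable _ _
    simp [this]
  · rw [setIntegral_T2_eq_iterated hc]
    have : ∀ a : ℝ, ∫ b in (0:ℝ)..1, pd 1 f ![a, b] = 0 := fun a => by
      rw [intervalIntegral.integral_eq_sub_of_hasDerivAt
        (fun b _ => hasDerivAt_pd_one hd a b), h1, sub_self]
      exact ((hf.continuous_pd 1).comp (continuous_vec_pair.comp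
        (Continuous.prodMk_right a))).intervalIntegrable _ _
    simp [this]

theorem pd_mul {f g : (Fin 2 → ℝ) → ℝ} (hf : Differentiable ℝ f) (hg : Differentiable ℝ g)
    (k : Fin 2) (x : Fin 2 → ℝ) :
    pd k (fun y => f y * g y) x = pd k f x * g x + f x * pd k g x := by
  simp only [pd]
  rw [fderiv_fun_mul (hf x) (hg x)]
  simp; ring

/-- Integration by parts on the torus. -/
theorem setIntegral_T2_mul_pd {f g : (Fin 2 → ℝ) → ℝ} (hf : ContDiff ℝ 1 f)
    (hg : ContDiff ℝ 1 g) (hfp : Per f) (hgp : Per g) (k : Fin 2) :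
    ∫ x in T2, f x * pd k g x = -∫ x in T2, pd k f x * g x := by
  have h := setIntegral_T2_pd_eq_zero (hf.mul hg) (fun x i => by simp only [hfp x i, hgp x i]) k
  have hdf := hf.differentiable (by norm_num)
  have hdg := hg.differentiable (by norm_num)
  simp only [pd_mul hdf hdg] at h
  rw [integral_add] at h
  · linarith
  · exact ((hf.continuous_pd k).mul hg.continuous).integrableOn_T2
  · exact (hf.continuous.mul (hg.continuous_pd k)).integrableOn_T2

theorem pd_comm {f : (Fin 2 → ℝ) → ℝ} (hf : ContDiff ℝ (⊤ : ℕ∞) f) (k l : Fin 2) :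
    pd k (pd l f) = pd l (pd k f) := by
  have hd : Differentiable ℝ (fderiv ℝ f) :=
    ((contDiff_infty.1 hf 2).fderiv_right (m := 1) (by norm_num)).differentiable (by norm_num)
  have h (v w : Fin 2 → ℝ) (x : Fin 2 → ℝ) :
      fderiv ℝ (fun y => fderiv ℝ f y v) x w = fderiv ℝ (fderiv ℝ f) x w v := by
    rw [fderiv_clm_apply (hd x) (differentiableAt_const v)]
    simp
  ext x
  have hs : IsSymmSndFDerivAt ℝ f x :=
    (contDiff_infty.1 hf 2).contDiffAt.isSymmSndFDerivAt (by simp)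
  change fderiv ℝ (fun y => fderiv ℝ f y _) x _ = fderiv ℝ (fun y => fderiv ℝ f y _) x _
  rw [h, h, hs]

/-- On the torus, the Laplacian controls all second derivatives. -/
theorem setIntegral_T2_laplacian_sq {u : (Fin 2 → ℝ) → ℝ} (hu : ContDiff ℝ (⊤ : ℕ∞) u)
    (hp : Per u) :
    ∫ x in T2, (∑ k, pd k (pd k u) x) ^ 2 = ∑ k, ∑ l, ∫ x in T2, (pd k (pd l u) x) ^ 2 := by
  have h1 (k : Fin 2) : ContDiff ℝ (⊤ : ℕ∞) (pd k u) := hu.pd k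
  have h2 (k l : Fin 2) : ContDiff ℝ (⊤ : ℕ∞) (pd k (pd l u)) := (h1 l).pd k
  have key (k l : Fin 2) : ∫ x in T2, pd k (pd k u) x * pd l (pd l u) x
      = ∫ x in T2, (pd k (pd l u) x) ^ 2 := by
    rw [setIntegral_T2_mul_pd ((h1 k).pd k (n := 1)) ((hu.pd l (n := 1)))
      ((hp.pd k).pd k) (hp.pd l) l]
    have e : pd l (pd k (pd k u)) = pd k (pd k (pd l u)) := by
      rw [pd_comm (h1 k) l k, pd_comm hu l k]
    have := setIntegral_T2_mul_pd (hu.pd l (n := 1)) ((h1 l).pd k (n := 1))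
      (hp.pd l) ((hp.pd l).pd k) k
    simp only [e, mul_comm _ (pd l u _)]
    rw [this, neg_neg]
    simp only [sq]
  simp only [← key]
  simp only [sq, Finset.sum_mul_sum]
  have hi (k l : Fin 2) : IntegrableOn (fun x => pd k (pd k u) x * pd l (pd l u) x) T2 :=
    ((h2 k k).continuous.mul (h2 l l).continuous).integrableOn_T2
  rw [integral_finsetSum _ fun k _ => integrable_finsetSum _ fun l _ => hi k l]
  exact Finset.sum_congr rfl fun k _ => integral_finsetSum _ fun l _ => hi k l

/-- One-dimensional Agmon-type bound on the unit interval. -/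
theorem sq_le_integral_unitInterval {f f' : ℝ → ℝ} (hf : ∀ s, HasDerivAt f (f' s) s)
    (hf' : Continuous f') {δ : ℝ} (hδ : 0 < δ) {x : ℝ} (hx : x ∈ Set.Icc (0:ℝ) 1) :
    f x ^ 2 ≤ ∫ s in (0:ℝ)..1, ((1 + 1 / δ) * f s ^ 2 + δ * f' s ^ 2) := by
  have hc : Continuous f := continuous_iff_continuousAt.2 fun s => (hf s).continuousAt
  have hii {g : ℝ → ℝ} (hg : Continuous g) (a b : ℝ) : IntervalIntegrable g volume a b :=
    hg.intervalIntegrable a b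
  set K : ℝ := ∫ r in (0:ℝ)..1, (1 / δ * f r ^ 2 + δ * f' r ^ 2) with hK
  have hpt (r : ℝ) : |2 * f r * f' r| ≤ 1 / δ * f r ^ 2 + δ * f' r ^ 2 := by
    have h1 : 1 / δ * (f r + δ * f' r) ^ 2 = 1 / δ * f r ^ 2 + δ * f' r ^ 2 + 2 * f r * f' r := by
      field_simp; ring
    have h2 : 1 / δ * (f r - δ * f' r) ^ 2 = 1 / δ * f r ^ 2 + δ * f' r ^ 2 - 2 * f r * f' r := by
      field_simp; ring
    have h3 : 0 ≤ 1 / δ * (f r + δ * f' r) ^ 2 := by positivity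
    have h4 : 0 ≤ 1 / δ * (f r - δ * f' r) ^ 2 := by positivity
    rw [abs_le]
    constructor <;> linarith
  have hcont : Continuous fun r => 2 * f r * f' r := by fun_prop
  have hs : ∀ s ∈ Set.Icc (0:ℝ) 1, f x ^ 2 ≤ f s ^ 2 + K := fun s hs => by
    have h1 : ∫ r in s..x, 2 * f r * f' r = f x ^ 2 - f s ^ 2 :=
      intervalIntegral.integral_eq_sub_of_hasDerivAt
        (f := fun r => f r ^ 2) (fun r _ => by simpa using! (hf r).pow 2) (hii hcont _ _)
    have h2 : |∫ r in s..x, 2 * f r * f' r| ≤ ∫ r in Set.uIoc s x, |2 * f r * f' r| := by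
      simpa only [Real.norm_eq_abs] using intervalIntegral.norm_integral_le_integral_norm_uIoc
        (f := fun r => 2 * f r * f' r) (a := s) (b := x) (μ := volume)
    have hsub : Set.uIoc s x ⊆ Set.Ioc (0:ℝ) 1 := by
      intro r hr
      rcases Set.mem_uIoc.1 hr with h | h
      · exact ⟨hs.1.trans_lt h.1, h.2.trans hx.2⟩
      · exact ⟨hx.1.trans_lt h.1, h.2.trans hs.2⟩
    have h3 : ∫ r in Set.uIoc s x, |2 * f r * f' r| ≤ ∫ r in Set.Ioc (0:ℝ) 1, |2 * f r * f' r| :=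
      setIntegral_mono_set (hii hcont.abs 0 1).1 (ae_of_all _ fun _ => abs_nonneg _)
        hsub.eventuallyLE
    rw [← intervalIntegral.integral_of_le zero_le_one] at h3
    have h4 : ∫ r in (0:ℝ)..1, |2 * f r * f' r| ≤ K :=
      intervalIntegral.integral_mono_on zero_le_one (hii hcont.abs _ _)
        (hii (by fun_prop) _ _) fun r _ => hpt r
    have := le_abs_self (∫ r in s..x, 2 * f r * f' r)
    linarith
  have h5 : ∫ _ in (0:ℝ)..1, f x ^ 2 ≤ ∫ s in (0:ℝ)..1, (f s ^ 2 + K) :=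
    intervalIntegral.integral_mono_on zero_le_one (hii continuous_const _ _)
      (hii (by fun_prop) _ _) hs
  rw [intervalIntegral.integral_add (hii (by fun_prop) _ _) (hii continuous_const _ _)] at h5
  simp only [intervalIntegral.integral_const, sub_zero, one_smul] at h5
  refine h5.trans (le_of_eq ?_)
  rw [hK, ← intervalIntegral.integral_add (hii (by fun_prop) _ _) (hii (by fun_prop) _ _)]
  congr 1
  ext s
  ring

/-- Ladyzhenskaya-type product estimate on the unit square. -/
theorem setIntegral_T2_sq_mul_sq_le {f h : (Fin 2 → ℝ) → ℝ} (hf : ContDiff ℝ 1 f)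
    (hh : ContDiff ℝ 1 h) {δ : ℝ} (hδ : 0 < δ) :
    ∫ x in T2, f x ^ 2 * h x ^ 2
      ≤ (∫ x in T2, (2 * f x ^ 2 + pd 0 f x ^ 2))
        * ∫ x in T2, ((1 + 1 / δ) * h x ^ 2 + δ * pd 1 h x ^ 2) := by
  have hfc := hf.continuous
  have hhc := hh.continuous
  have hfd := hf.continuous_pd 0
  have hhd := hh.continuous_pd 1
  have hdf := hf.differentiable (by norm_num)
  have hdh := hh.differentiable (by norm_num)
  have hv := continuous_vec_pair
  have hv' : Continuous (fun p : ℝ × ℝ => (![p.2, p.1] : Fin 2 → ℝ)) := hv.comp continuous_swap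
  have hl (b : ℝ) : Continuous (fun a : ℝ => (![a, b] : Fin 2 → ℝ)) :=
    hv.comp (Continuous.prodMk_left b)
  have hr (a : ℝ) : Continuous (fun b : ℝ => (![a, b] : Fin 2 → ℝ)) :=
    hv.comp (Continuous.prodMk_right a)
  have hc1 : Continuous fun x => 2 * f x ^ 2 + pd 0 f x ^ 2 := by fun_prop
  have hc2 : Continuous fun x => (1 + 1 / δ) * h x ^ 2 + δ * pd 1 h x ^ 2 := by fun_prop
  have hc3 : Continuous fun x => f x ^ 2 * h x ^ 2 := by fun_prop
  set A : ℝ → ℝ := fun b => ∫ a in (0:ℝ)..1, (2 * f ![a, b] ^ 2 + pd 0 f ![a, b] ^ 2) with hA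
  set B : ℝ → ℝ := fun a =>
    ∫ b in (0:ℝ)..1, ((1 + 1 / δ) * h ![a, b] ^ 2 + δ * pd 1 h ![a, b] ^ 2) with hB
  have hAc : Continuous A :=
    intervalIntegral.continuous_parametric_intervalIntegral_of_continuous'
      (f := fun b a => 2 * f ![a, b] ^ 2 + pd 0 f ![a, b] ^ 2) (hc1.comp hv') 0 1
  have hBc : Continuous B :=
    intervalIntegral.continuous_parametric_intervalIntegral_of_continuous'
      (f := fun a b => (1 + 1 / δ) * h ![a, b] ^ 2 + δ * pd 1 h ![a, b] ^ 2) (hc2.comp hv) 0 1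
  have hfA : ∀ a ∈ Set.Icc (0:ℝ) 1, ∀ b, f ![a, b] ^ 2 ≤ A b := fun a ha b => by
    have := sq_le_integral_unitInterval (fun s => hasDerivAt_pd_zero hdf s b)
      (hfd.comp (hl b)) one_pos ha
    refine this.trans (le_of_eq ?_)
    simp only [hA]
    congr 1
    ext s
    norm_num
  have hhB : ∀ a, ∀ b ∈ Set.Icc (0:ℝ) 1, h ![a, b] ^ 2 ≤ B a := fun a b hb =>
    sq_le_integral_unitInterval (fun s => hasDerivAt_pd_one hdh a s) (hhd.comp (hr a)) hδ hb
  rw [setIntegral_T2_eq_iterated hc3, setIntegral_T2_eq_iterated_swap hc1,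
    setIntegral_T2_eq_iterated hc2, ← intervalIntegral.integral_const_mul]
  refine intervalIntegral.integral_mono_on zero_le_one ?_ ?_ fun a ha => ?_
  · exact (intervalIntegral.continuous_parametric_intervalIntegral_of_continuous'
      (f := fun a b => f ![a, b] ^ 2 * h ![a, b] ^ 2) (hc3.comp hv) 0 1).intervalIntegrable _ _
  · exact (continuous_const.mul hBc).intervalIntegrable _ _
  · change _ ≤ (∫ b in (0:ℝ)..1, A b) * B a
    rw [← intervalIntegral.integral_mul_const]
    refine intervalIntegral.integral_mono_on zero_le_one ((hc3.comp (hr a)).intervalIntegrable _ _)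
      ((hAc.mul continuous_const).intervalIntegrable _ _) fun b hb => ?_
    exact mul_le_mul (hfA a ha b) (hhB a b hb) (sq_nonneg _)
      ((sq_nonneg _).trans (hfA a ha b))

section TimeDependent

variable {u : ℝ → (Fin 2 → ℝ) → ℝ}

theorem contDiff_slice (hu : ContDiff ℝ (⊤ : ℕ∞) fun p : ℝ × (Fin 2 → ℝ) => u p.1 p.2) (t : ℝ) :
    ContDiff ℝ (⊤ : ℕ∞) (u t) :=
  hu.comp (contDiff_prodMk_right t)

theorem pd_slice_eq_fderiv (hu : ContDiff ℝ (⊤ : ℕ∞) fun p : ℝ × (Fin 2 → ℝ) => u p.1 p.2)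
    (k : Fin 2) (t : ℝ) (x : Fin 2 → ℝ) :
    pd k (u t) x
      = fderiv ℝ (fun p : ℝ × (Fin 2 → ℝ) => u p.1 p.2) (t, x) (0, Pi.single k 1) := by
  have h := ((hu.differentiable (by simp)) (t, x)).hasFDerivAt.comp x
    (hasFDerivAt_prodMk_right (𝕜 := ℝ) t x)
  have h' : HasFDerivAt (u t) _ x := h
  rw [pd, h'.fderiv]
  simp

theorem hasDerivAt_slice (hu : ContDiff ℝ (⊤ : ℕ∞) fun p : ℝ × (Fin 2 → ℝ) => u p.1 p.2)
    (t : ℝ) (x : Fin 2 → ℝ) :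
    HasDerivAt (fun s => u s x)
      (fderiv ℝ (fun p : ℝ × (Fin 2 → ℝ) => u p.1 p.2) (t, x) (1, 0)) t := by
  have h := ((hu.differentiable (by simp)) (t, x)).hasFDerivAt.comp t
    (hasFDerivAt_prodMk_left (𝕜 := ℝ) t x)
  have h' : HasFDerivAt (fun s => u s x) _ t := h
  simpa using! h'.hasDerivAt

theorem contDiff_fderiv_apply {F : ℝ × (Fin 2 → ℝ) → ℝ} (hF : ContDiff ℝ (⊤ : ℕ∞) F)
    (v : ℝ × (Fin 2 → ℝ)) : ContDiff ℝ (⊤ : ℕ∞) fun p => fderiv ℝ F p v :=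
  (hF.fderiv_right (m := (⊤ : ℕ∞)) (by exact_mod_cast le_top)).clm_apply contDiff_const

theorem contDiff_pd_joint (hu : ContDiff ℝ (⊤ : ℕ∞) fun p : ℝ × (Fin 2 → ℝ) => u p.1 p.2)
    (k : Fin 2) : ContDiff ℝ (⊤ : ℕ∞) fun p : ℝ × (Fin 2 → ℝ) => pd k (u p.1) p.2 := by
  simp only [pd_slice_eq_fderiv hu]
  exact contDiff_fderiv_apply hu _

theorem contDiff_deriv_joint (hu : ContDiff ℝ (⊤ : ℕ∞) fun p : ℝ × (Fin 2 → ℝ) => u p.1 p.2) :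
    ContDiff ℝ (⊤ : ℕ∞) fun p : ℝ × (Fin 2 → ℝ) => deriv (fun s => u s p.2) p.1 := by
  simp only [fun t x => (hasDerivAt_slice hu t x).deriv]
  exact contDiff_fderiv_apply hu _

theorem deriv_pd_comm (hu : ContDiff ℝ (⊤ : ℕ∞) fun p : ℝ × (Fin 2 → ℝ) => u p.1 p.2)
    (k : Fin 2) (t : ℝ) (x : Fin 2 → ℝ) :
    deriv (fun s => pd k (u s) x) t = pd k (fun y => deriv (fun s => u s y) t) x := by
  rw [(hasDerivAt_slice (contDiff_pd_joint hu k) t x).deriv,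
    pd_slice_eq_fderiv (u := fun t y => deriv (fun s => u s y) t) (contDiff_deriv_joint hu)]
  simp only [pd_slice_eq_fderiv hu, fun t x => (hasDerivAt_slice hu t x).deriv]
  set F := fun p : ℝ × (Fin 2 → ℝ) => u p.1 p.2
  have hd : Differentiable ℝ (fderiv ℝ F) :=
    ((contDiff_infty.1 hu 2).fderiv_right (m := 1) (by norm_num)).differentiable (by norm_num)
  have h (v w p : ℝ × (Fin 2 → ℝ)) :
      fderiv ℝ (fun q => fderiv ℝ F q v) p w = fderiv ℝ (fderiv ℝ F) p w v := by
    rw [fderiv_clm_apply (hd p) (differentiableAt_const v)]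
    simp
  have hs : IsSymmSndFDerivAt ℝ F (t, x) :=
    (contDiff_infty.1 hu 2).contDiffAt.isSymmSndFDerivAt (by simp)
  rw [h, h, hs]

/-- Differentiation under the integral over the torus. -/
theorem hasDerivAt_setIntegral_T2
    (hu : ContDiff ℝ (⊤ : ℕ∞) fun p : ℝ × (Fin 2 → ℝ) => u p.1 p.2) (t : ℝ) :
    HasDerivAt (fun s => ∫ x in T2, u s x) (∫ x in T2, deriv (fun s => u s x) t) t := by
  have hc := (contDiff_deriv_joint hu).continuous
  obtain ⟨M, hM⟩ := ((isCompact_closedBall t 1).prod isCompact_T2).exists_bound_of_continuousOn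
    hc.continuousOn
  have hcs (s : ℝ) : Continuous (u s) := (contDiff_slice hu s).continuous
  refine (hasDerivAt_integral_of_dominated_loc_of_deriv_le (μ := volume.restrict T2)
    (F' := fun s x => deriv (fun r => u r x) s) (bound := fun _ => M)
    (Metric.closedBall_mem_nhds t one_pos)
    (Filter.Eventually.of_forall fun s => (hcs s).aestronglyMeasurable)
    (hcs t).integrableOn_T2 ?_ ?_ continuous_const.integrableOn_T2 ?_).2
  · exact (hc.comp (Continuous.prodMk_right t)).aestronglyMeasurable
  · filter_upwards [ae_restrict_mem measurableSet_T2] with x hx s hs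
    exact hM (s, x) ⟨hs, hx⟩
  · exact ae_of_all _ fun x s _ => (hasDerivAt_slice hu s x).differentiableAt.hasDerivAt

theorem hasDerivAt_setIntegral_T2_sq
    (hu : ContDiff ℝ (⊤ : ℕ∞) fun p : ℝ × (Fin 2 → ℝ) => u p.1 p.2) (t : ℝ) :
    HasDerivAt (fun s => ∫ x in T2, u s x ^ 2)
      (2 * ∫ x in T2, u t x * deriv (fun s => u s x) t) t := by
  convert hasDerivAt_setIntegral_T2 (u := fun s x => u s x ^ 2) (hu.pow 2) t using 1
  rw [← integral_const_mul]
  congr 1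
  ext x
  have := (hasDerivAt_slice hu t x).differentiableAt.hasDerivAt.pow 2
  rw [HasDerivAt.deriv (f := fun s => u s x ^ 2) this]
  ring

/-- Derivative of the squared `H¹` norm, tested with `u - Δu`. -/
theorem hasDerivAt_energy
    (hu : ContDiff ℝ (⊤ : ℕ∞) fun p : ℝ × (Fin 2 → ℝ) => u p.1 p.2) (hp : ∀ t, Per (u t)) (t : ℝ) :
    HasDerivAt (fun s => (∫ x in T2, u s x ^ 2) + ∑ k, ∫ x in T2, pd k (u s) x ^ 2)
      (2 * ∫ x in T2, (u t x - ∑ k, pd k (pd k (u t)) x) * deriv (fun s => u s x) t) t := by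
  have h := (hasDerivAt_setIntegral_T2_sq hu t).add (HasDerivAt.fun_sum (u := Finset.univ)
    fun k _ => hasDerivAt_setIntegral_T2_sq (u := fun s x => pd k (u s) x)
      (contDiff_pd_joint hu k) t)
  refine h.congr_deriv ?_
  have hut := contDiff_slice hu t
  have hvt : ContDiff ℝ (⊤ : ℕ∞) fun y => deriv (fun s => u s y) t :=
    contDiff_slice (u := fun t y => deriv (fun s => u s y) t) (contDiff_deriv_joint hu) t
  have hvp : Per fun y => deriv (fun s => u s y) t := fun x i => by
    simp only [fun s => hp s x i]
  have hone {f : (Fin 2 → ℝ) → ℝ} (hf : ContDiff ℝ (⊤ : ℕ∞) f) : ContDiff ℝ 1 f :=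
    contDiff_infty.1 hf 1
  have key (k : Fin 2) : ∫ x in T2, pd k (u t) x * deriv (fun s => pd k (u s) x) t
      = -∫ x in T2, pd k (pd k (u t)) x * deriv (fun s => u s x) t := by
    simp only [deriv_pd_comm hu]
    exact setIntegral_T2_mul_pd (hut.pd k (n := 1)) (hone hvt) ((hp t).pd k) hvp k
  have hi (k : Fin 2) :
      IntegrableOn (fun x => pd k (pd k (u t)) x * deriv (fun s => u s x) t) T2 :=
    (((hut.pd k (n := ⊤)).pd k (n := 1)).continuous.mul hvt.continuous).integrableOn_T2
  have hi0 : IntegrableOn (fun x => u t x * deriv (fun s => u s x) t) T2 :=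
    (hut.continuous.mul hvt.continuous).integrableOn_T2
  simp only [key, sub_mul, Finset.sum_mul]
  rw [integral_sub hi0 (integrable_finsetSum _ fun k _ => hi k),
    integral_finsetSum _ fun k _ => hi k]
  simp only [Fin.sum_univ_two]
  ring

end TimeDependent

/-- Pointwise form of the estimate for the elliptic operator tested with `u - Δu`. -/
theorem tested_operator_pointwise_le {ζ L ε c : ℝ} (hζ : 0 < ζ) (hc : c = 1 / 2 + 2 / ζ)
    (u D g : ℝ) (a H da : Fin 2 → Fin 2 → ℝ) (du : Fin 2 → ℝ) (ha : ∀ l k, |a l k| ≤ ε) :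
    (u - D) * (ζ * D + 2 * L * (∑ k, ∑ l, (H k l * a l k + du l * da k l)) + g)
      ≤ ζ * (u * D) - (7 / 8 * ζ) * D ^ 2 + 1 / 2 * u ^ 2
        + c * (48 * L ^ 2) * ε ^ 2 * (∑ k, ∑ l, H k l ^ 2)
        + c * (48 * L ^ 2) * (∑ k, ∑ l, da k l ^ 2 * du l ^ 2) + 3 * c * g ^ 2 := by
  have hc0 : 0 < c := by rw [hc]; positivity
  have ha2 (l k : Fin 2) : (H k l * a l k) ^ 2 ≤ ε ^ 2 * H k l ^ 2 := by
    rw [mul_pow, mul_comm]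
    exact mul_le_mul_of_nonneg_right (sq_le_sq' (abs_le.1 (ha l k)).1 (abs_le.1 (ha l k)).2)
      (sq_nonneg _)
  have four (p q r s : ℝ) : (p + q + (r + s)) ^ 2 ≤ 4 * (p ^ 2 + q ^ 2 + (r ^ 2 + s ^ 2)) := by
    nlinarith [sq_nonneg (p - q), sq_nonneg (p - r), sq_nonneg (p - s), sq_nonneg (q - r),
      sq_nonneg (q - s), sq_nonneg (r - s)]
  set R₁ : ℝ := ∑ k, ∑ l, H k l * a l k with hR₁
  set R₂ : ℝ := ∑ k, ∑ l, du l * da k l with hR₂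
  set S : ℝ := ∑ k, ∑ l, H k l ^ 2 with hS
  set P : ℝ := ∑ k, ∑ l, da k l ^ 2 * du l ^ 2 with hP
  have h1 : R₁ ^ 2 ≤ 4 * (ε ^ 2 * S) := by
    simp only [hR₁, hS, Fin.sum_univ_two]
    refine (four _ _ _ _).trans ?_
    linarith [ha2 0 0, ha2 0 1, ha2 1 0, ha2 1 1]
  have h2 : R₂ ^ 2 ≤ 4 * P := by
    simp only [hR₂, hP, Fin.sum_univ_two]
    refine (four _ _ _ _).trans (le_of_eq ?_)
    ring
  have hR : ∑ k, ∑ l, (H k l * a l k + du l * da k l) = R₁ + R₂ := by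
    simp only [hR₁, hR₂, Finset.sum_add_distrib]
  rw [hR]
  set N : ℝ := 2 * L * (R₁ + R₂) + g with hN
  have hN2 : N ^ 2 ≤ 3 * (4 * L ^ 2 * R₁ ^ 2 + 4 * L ^ 2 * R₂ ^ 2 + g ^ 2) := by
    rw [hN]
    nlinarith [sq_nonneg (2 * L * R₁ - 2 * L * R₂), sq_nonneg (2 * L * R₁ - g),
      sq_nonneg (2 * L * R₂ - g)]
  have hN3 : N ^ 2 ≤ 48 * L ^ 2 * ε ^ 2 * S + 48 * L ^ 2 * P + 3 * g ^ 2 := by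
    nlinarith [mul_le_mul_of_nonneg_left h1 (sq_nonneg L),
      mul_le_mul_of_nonneg_left h2 (sq_nonneg L)]
  have hy : (u - D) * N ≤ 1 / 2 * u ^ 2 + ζ / 8 * D ^ 2 + c * N ^ 2 := by
    have e : ζ / 8 * D ^ 2 + D * N + 2 / ζ * N ^ 2 = ζ / 8 * (D + 4 / ζ * N) ^ 2 := by
      field_simp; ring
    have : 0 ≤ ζ / 8 * (D + 4 / ζ * N) ^ 2 := by positivity
    rw [hc]
    nlinarith [sq_nonneg (u - N)]
  have hcN := mul_le_mul_of_nonneg_left hN3 hc0.le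
  have e : (u - D) * (ζ * D + 2 * L * (R₁ + R₂) + g) = ζ * (u * D) - ζ * D ^ 2 + (u - D) * N := by
    rw [hN]; ring
  rw [e]
  linarith

/-- The `H¹` energy estimate for a scalar component, at a fixed time. -/
theorem scalar_energy_estimate {ζ L ε δ c M : ℝ} (hζ : 0 < ζ) (hc : c = 1 / 2 + 2 / ζ)
    (hδ : 0 < δ) (hM : 0 ≤ M) (hε : c * (48 * L ^ 2) * ε ^ 2 ≤ ζ / 8)
    (hδM : c * (48 * L ^ 2) * (2 * M * δ) ≤ ζ / 8)
    {u v g : (Fin 2 → ℝ) → ℝ} {a : Fin 2 → Fin 2 → (Fin 2 → ℝ) → ℝ}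
    (hu : ContDiff ℝ (⊤ : ℕ∞) u) (hup : Per u) (hv : Continuous v) (hg : Continuous g)
    (ha : ∀ l k, ContDiff ℝ (⊤ : ℕ∞) (a l k)) (haε : ∀ l k x, |a l k x| ≤ ε)
    (haM : ∀ k l, ∫ x in T2, (2 * pd k (a l k) x ^ 2 + pd 0 (pd k (a l k)) x ^ 2) ≤ M)
    (heq : ∀ x, v x = ζ * (∑ k, pd k (pd k u) x)
      + 2 * L * (∑ k, pd k (fun y => ∑ l, pd l u y * a l k y) x) + g x) :
    (∫ x in T2, (u x - ∑ k, pd k (pd k u) x) * v x)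
        + ζ / 2 * ((∑ k, ∫ x in T2, pd k u x ^ 2) + ∫ x in T2, (∑ k, pd k (pd k u) x) ^ 2)
      ≤ (1 / 2 + c * (48 * L ^ 2) * (2 * M * (1 + 1 / δ)) + 3 * c)
          * ((∫ x in T2, u x ^ 2) + ∑ k, ∫ x in T2, pd k u x ^ 2)
        + (1 / 2 + c * (48 * L ^ 2) * (2 * M * (1 + 1 / δ)) + 3 * c) * ∫ x in T2, g x ^ 2 := by
  have hc0 : 0 < c := by rw [hc]; positivity
  have hd (l : Fin 2) : ContDiff ℝ (⊤ : ℕ∞) (pd l u) := hu.pd l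
  have hdd (k l : Fin 2) : ContDiff ℝ (⊤ : ℕ∞) (pd k (pd l u)) := (hd l).pd k
  have hda (k l : Fin 2) : ContDiff ℝ (⊤ : ℕ∞) (pd k (a l k)) := (ha l k).pd k
  have hcu := hu.continuous
  have hcd (l : Fin 2) := (hd l).continuous
  have hcdd (k l : Fin 2) := (hdd k l).continuous
  have hcda (k l : Fin 2) := (hda k l).continuous
  have hone {f : (Fin 2 → ℝ) → ℝ} (hf : ContDiff ℝ (⊤ : ℕ∞) f) : ContDiff ℝ 1 f :=
    contDiff_infty.1 hf 1
  have hexp (k : Fin 2) (x : Fin 2 → ℝ) : pd k (fun y => ∑ l, pd l u y * a l k y) x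
      = ∑ l, (pd k (pd l u) x * a l k x + pd l u x * pd k (a l k) x) := by
    have hdl (l : Fin 2) := (hd l).differentiable (by simp)
    have hal (l : Fin 2) := (ha l k).differentiable (by simp)
    simp only [← fun l => pd_mul (hdl l) (hal l) k x]
    rw [pd, fderiv_fun_sum (A := fun l y => pd l u y * a l k y)
      fun l _ => ((hdl l).mul (hal l)) x]
    simp [pd]
  set X := ∫ x in T2, u x ^ 2 with hX
  set Y := ∑ k, ∫ x in T2, pd k u x ^ 2 with hY
  set Z := ∫ x in T2, (∑ k, pd k (pd k u) x) ^ 2 with hZ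
  set W := ∫ x in T2, g x ^ 2 with hW
  have hX0 : 0 ≤ X := integral_nonneg fun x => sq_nonneg _
  have hW0 : 0 ≤ W := integral_nonneg fun x => sq_nonneg _
  have hZ0 : 0 ≤ Z := integral_nonneg fun x => sq_nonneg _
  have hY0 : 0 ≤ Y := Finset.sum_nonneg fun k _ => integral_nonneg fun x => sq_nonneg _
  have hZ' : ∑ k, ∑ l, ∫ x in T2, pd k (pd l u) x ^ 2 = Z :=
    (setIntegral_T2_laplacian_sq hu hup).symm
  have hS : ∫ x in T2, ∑ k, ∑ l, pd k (pd l u) x ^ 2 = Z := by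
    rw [← hZ', integral_finsetSum _ fun k _ =>
      Continuous.integrableOn_T2 (by fun_prop)]
    exact Finset.sum_congr rfl fun k _ => integral_finsetSum _ fun l _ =>
      Continuous.integrableOn_T2 (by fun_prop)
  have hIBP : ∫ x in T2, u x * ∑ k, pd k (pd k u) x = -Y := by
    simp only [Finset.mul_sum]
    rw [integral_finsetSum _ fun k _ => Continuous.integrableOn_T2 (by fun_prop), hY,
      ← Finset.sum_neg_distrib]
    refine Finset.sum_congr rfl fun k _ => ?_
    rw [setIntegral_T2_mul_pd (hone hu) (hone (hd k)) hup (hup.pd k) k]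
    simp only [sq]
  have hP : ∫ x in T2, ∑ k, ∑ l, pd k (a l k) x ^ 2 * pd l u x ^ 2
      ≤ 2 * M * ((1 + 1 / δ) * Y + δ * Z) := by
    have h1 (k l : Fin 2) : ∫ x in T2, pd k (a l k) x ^ 2 * pd l u x ^ 2
        ≤ M * ((1 + 1 / δ) * (∫ x in T2, pd l u x ^ 2)
          + δ * ∫ x in T2, pd 1 (pd l u) x ^ 2) := by
      refine (setIntegral_T2_sq_mul_sq_le (hone (hda k l)) (hone (hd l)) hδ).trans ?_
      rw [← integral_const_mul (1 + 1 / δ), ← integral_const_mul δ, ← integral_add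
        (Continuous.integrableOn_T2 (by fun_prop)) (Continuous.integrableOn_T2 (by fun_prop))]
      exact mul_le_mul_of_nonneg_right (haM k l) (integral_nonneg fun x => by positivity)
    have h2 : ∑ l, ∫ x in T2, pd 1 (pd l u) x ^ 2 ≤ Z := by
      rw [← hZ', Fin.sum_univ_two (f := fun k => ∑ l, ∫ x in T2, pd k (pd l u) x ^ 2)]
      exact le_add_of_nonneg_left
        (Finset.sum_nonneg fun l _ => integral_nonneg fun x => sq_nonneg _)
    have h3 : M * (δ * ∑ l, ∫ x in T2, pd 1 (pd l u) x ^ 2) ≤ M * (δ * Z) := by gcongr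
    rw [integral_finsetSum _ fun k _ => Continuous.integrableOn_T2 (by fun_prop)]
    simp only [fun k => integral_finsetSum (μ := volume.restrict T2) Finset.univ
      (f := fun l x => pd k (a l k) x ^ 2 * pd l u x ^ 2)
      fun l _ => Continuous.integrableOn_T2 (by fun_prop)]
    simp only [Fin.sum_univ_two] at hY h3 ⊢
    rw [hY]
    linarith [h1 0 0, h1 0 1, h1 1 0, h1 1 1]
  have hmain : ∫ x in T2, (u x - ∑ k, pd k (pd k u) x) * v x
      ≤ ζ * (-Y) - (7 / 8 * ζ) * Z + 1 / 2 * X + c * (48 * L ^ 2) * ε ^ 2 * Z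
        + c * (48 * L ^ 2) * (∫ x in T2, ∑ k, ∑ l, pd k (a l k) x ^ 2 * pd l u x ^ 2)
        + 3 * c * W := by
    have hi {f : (Fin 2 → ℝ) → ℝ} (hf : Continuous f) : Integrable f (volume.restrict T2) :=
      hf.integrableOn_T2
    refine (integral_mono (hi (by fun_prop)) (hi ?_) fun x => ?_).trans (le_of_eq (a := ∫ x in T2,
      (ζ * (u x * ∑ k, pd k (pd k u) x) - (7 / 8 * ζ) * (∑ k, pd k (pd k u) x) ^ 2
        + 1 / 2 * u x ^ 2 + c * (48 * L ^ 2) * ε ^ 2 * (∑ k, ∑ l, pd k (pd l u) x ^ 2)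
        + c * (48 * L ^ 2) * (∑ k, ∑ l, pd k (a l k) x ^ 2 * pd l u x ^ 2)
        + 3 * c * g x ^ 2)) ?_)
    · fun_prop
    · simp only [heq, hexp]
      exact tested_operator_pointwise_le hζ hc (u x) (∑ k, pd k (pd k u) x) (g x)
        (fun l k => a l k x) (fun k l => pd k (pd l u) x) (fun k l => pd k (a l k) x)
        (fun l => pd l u x) fun l k => haε l k x
    · rw [integral_add (hi (by fun_prop)) (hi (by fun_prop)),
        integral_add (hi (by fun_prop)) (hi (by fun_prop)),
        integral_add (hi (by fun_prop)) (hi (by fun_prop)),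
        integral_add (hi (by fun_prop)) (hi (by fun_prop)),
        integral_sub (hi (by fun_prop)) (hi (by fun_prop))]
      simp only [integral_const_mul, hIBP, hS]
      rw [hZ, hX, hW]
  have hκ : 0 ≤ c * (48 * L ^ 2) := by positivity
  have e1 := mul_le_mul_of_nonneg_left hP hκ
  have e2 := mul_le_mul_of_nonneg_right hε hZ0
  have e3 := mul_le_mul_of_nonneg_right hδM hZ0
  set J := c * (48 * L ^ 2) * (2 * M * (1 + 1 / δ)) with hJ
  have hJ0 : 0 ≤ J := by positivity
  have e4 : c * (48 * L ^ 2) * (2 * M * ((1 + 1 / δ) * Y + δ * Z))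
      = J * Y + c * (48 * L ^ 2) * (2 * M * δ) * Z := by rw [hJ]; ring
  rw [e4] at e1
  have p1 : 0 ≤ J * X := by positivity
  have p2 : 0 ≤ J * W := by positivity
  have p3 : 0 ≤ c * X := by positivity
  have p4 : 0 ≤ c * Y := by positivity
  have p5 : 0 ≤ ζ * Y := by positivity
  have p6 : 0 ≤ ζ * Z := by positivity
  linarith

theorem setIntegral_T2_double_sum {f : Fin 2 → Fin 2 → (Fin 2 → ℝ) → ℝ}
    (hf : ∀ i j, Continuous (f i j)) :
    ∫ x in T2, ∑ i, ∑ j, f i j x = ∑ i, ∑ j, ∫ x in T2, f i j x := by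
  rw [integral_finsetSum _ fun i _ => Continuous.integrableOn_T2 (by fun_prop)]
  exact Finset.sum_congr rfl fun i _ => integral_finsetSum _ fun j _ => (hf i j).integrableOn_T2

theorem setIntegral_T2_triple_sum {f : Fin 2 → Fin 2 → Fin 2 → (Fin 2 → ℝ) → ℝ}
    (hf : ∀ k i j, Continuous (f k i j)) :
    ∫ x in T2, ∑ k, ∑ i, ∑ j, f k i j x = ∑ i, ∑ j, ∑ k, ∫ x in T2, f k i j x := by
  rw [integral_finsetSum _ fun k _ => Continuous.integrableOn_T2 (by fun_prop)]
  simp only [fun k => setIntegral_T2_double_sum (hf k)]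
  rw [Finset.sum_comm]
  exact Finset.sum_congr rfl fun i _ => Finset.sum_comm

theorem le_double_sum {f : Fin 2 → Fin 2 → ℝ} (hf : ∀ i j, 0 ≤ f i j) (i j : Fin 2) :
    f i j ≤ ∑ i, ∑ j, f i j :=
  (Finset.single_le_sum (fun j _ => hf i j) (Finset.mem_univ j)).trans
    (Finset.single_le_sum (f := fun i => ∑ j, f i j)
      (fun i _ => Finset.sum_nonneg fun j _ => hf i j) (Finset.mem_univ i))

/-- A priori `H¹`-level energy inequality for the linear parabolic problem
`∂ₜQ_{ij} − ζΔQ_{ij} − 2L₄∂ₖ(∂ₗQ_{ij}(Q₀)_{lk}) = G_{ij}` on `𝕋²`: for `ζ > 0` there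
exist a smallness threshold `ε > 0` for `‖Q₀‖_{L^∞}` and a constant `C > 0` (depending
only on `L₄, ζ`, the `H²` bound `B` of `Q₀` and `𝕋²`) such that testing with `Q − ΔQ`
gives `(d/dt)(‖Q‖²_{L²} + ‖∇Q‖²_{L²})/2 + (ζ/2)(‖∇Q‖²_{L²} + ‖ΔQ‖²_{L²})
 ≤ C(‖Q‖²_{L²} + ‖∇Q‖²_{L²}) + C‖G‖²_{L²}`. -/
theorem linear_parabolic_energy_inequality (ζ L₄ B : ℝ) (hζ : 0 < ζ) :
    ∃ ε > 0, ∃ C > 0,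
      ∀ (Q₀ : (Fin 2 → ℝ) → Matrix (Fin 2) (Fin 2) ℝ)
        (Q G : ℝ → (Fin 2 → ℝ) → Matrix (Fin 2) (Fin 2) ℝ),
        (∀ i j, ContDiff ℝ (⊤ : ℕ∞) (fun x => Q₀ x i j)) →
        (∀ i j, Per (fun x => Q₀ x i j)) →
        (∀ x, (Q₀ x).IsSymm) → (∀ x, (Q₀ x).trace = 0) →
        (∀ x, Real.sqrt (∑ i, ∑ j, (Q₀ x i j)^2) ≤ ε) →
        (∫ x in T2,
            (∑ i, ∑ j, (Q₀ x i j)^2)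
              + (∑ k, ∑ i, ∑ j, (pd k (fun y => Q₀ y i j) x)^2)
              + (∑ k, ∑ l, ∑ i, ∑ j, (pd k (pd l (fun y => Q₀ y i j)) x)^2)) ≤ B^2 →
        (∀ i j, ContDiff ℝ (⊤ : ℕ∞) (fun p : ℝ × (Fin 2 → ℝ) => Q p.1 p.2 i j)) →
        (∀ t i j, Per (fun x => Q t x i j)) →
        (∀ t x, (Q t x).IsSymm) → (∀ t x, (Q t x).trace = 0) →
        (∀ i j, ContDiff ℝ (⊤ : ℕ∞) (fun p : ℝ × (Fin 2 → ℝ) => G p.1 p.2 i j)) →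
        (∀ t i j, Per (fun x => G t x i j)) →
        (∀ t x, (G t x).IsSymm) → (∀ t x, (G t x).trace = 0) →
        (∀ (t : ℝ) (x : Fin 2 → ℝ) (i j : Fin 2),
          deriv (fun s => Q s x i j) t
            - ζ * (∑ k, pd k (pd k (fun y => Q t y i j)) x)
            - 2 * L₄ * (∑ k, pd k (fun y =>
                ∑ l, pd l (fun z => Q t z i j) y * Q₀ y l k) x)
          = G t x i j) →
        ∀ t : ℝ,
          deriv (fun s => (1/2) *
              ((∫ x in T2, ∑ i, ∑ j, (Q s x i j)^2)
                + ∫ x in T2, ∑ k, ∑ i, ∑ j, (pd k (fun y => Q s y i j) x)^2)) t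
            + (ζ/2) * ((∫ x in T2, ∑ k, ∑ i, ∑ j, (pd k (fun y => Q t y i j) x)^2)
                + ∫ x in T2, ∑ i, ∑ j, (∑ k, pd k (pd k (fun y => Q t y i j)) x)^2)
          ≤ C * ((∫ x in T2, ∑ i, ∑ j, (Q t x i j)^2)
                + ∫ x in T2, ∑ k, ∑ i, ∑ j, (pd k (fun y => Q t y i j) x)^2)
            + C * ∫ x in T2, ∑ i, ∑ j, (G t x i j)^2 := by
  set c : ℝ := 1 / 2 + 2 / ζ with hc
  have hc0 : 0 < c := by positivity
  set κ : ℝ := c * (48 * L₄ ^ 2) with hκ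
  have hκ0 : 0 ≤ κ := by positivity
  set M : ℝ := 2 * B ^ 2 with hM
  have hM0 : 0 ≤ M := by positivity
  set ε : ℝ := Real.sqrt (ζ / (8 * (κ + 1))) with hε
  set δ : ℝ := ζ / (8 * (κ + 1) * (2 * M + 1)) with hδ
  have hδ0 : 0 < δ := by positivity
  have hε2 : κ * ε ^ 2 ≤ ζ / 8 := by
    rw [hε, Real.sq_sqrt (by positivity), ← sub_nonneg]
    have : ζ / 8 - κ * (ζ / (8 * (κ + 1))) = ζ / (8 * (κ + 1)) := by field_simp; ring
    rw [this]; positivity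
  have hδM : κ * (2 * M * δ) ≤ ζ / 8 := by
    rw [hδ, ← sub_nonneg]
    have : ζ / 8 - κ * (2 * M * (ζ / (8 * (κ + 1) * (2 * M + 1))))
        = ζ * (κ + 2 * M + 1) / (8 * (κ + 1) * (2 * M + 1)) := by field_simp; ring
    rw [this]; positivity
  refine ⟨ε, by positivity, 1 / 2 + κ * (2 * M * (1 + 1 / δ)) + 3 * c, by positivity, ?_⟩
  intro Q₀ Q G hQ₀ _ _ _ hsmall hB hQ hQp _ _ hG _ _ _ heq t
  have haε (l k : Fin 2) (x : Fin 2 → ℝ) : |Q₀ x l k| ≤ ε :=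
    (Real.abs_le_sqrt (le_double_sum (f := fun i j => Q₀ x i j ^ 2)
      (fun i j => sq_nonneg _) l k)).trans (hsmall x)
  have hc1 (k i j : Fin 2) : Continuous (pd k fun y => Q₀ y i j) :=
    ((hQ₀ i j).pd k (n := 1)).continuous
  have hc2 (k l i j : Fin 2) : Continuous (pd k (pd l fun y => Q₀ y i j)) :=
    (((hQ₀ i j).pd l (n := ⊤)).pd k (n := 1)).continuous
  have hc0' (i j : Fin 2) : Continuous fun y => Q₀ y i j := (hQ₀ i j).continuous
  have haM (k l : Fin 2) : ∫ x in T2, (2 * pd k (fun y => Q₀ y l k) x ^ 2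
      + pd 0 (pd k fun y => Q₀ y l k) x ^ 2) ≤ M := by
    refine le_trans ?_ (mul_le_mul_of_nonneg_left hB zero_le_two)
    rw [← integral_const_mul]
    refine integral_mono (Continuous.integrableOn_T2 (by fun_prop))
      (Continuous.integrableOn_T2 (by fun_prop)) fun x => ?_
    have n0 : 0 ≤ ∑ i, ∑ j, Q₀ x i j ^ 2 :=
      Finset.sum_nonneg fun i _ => Finset.sum_nonneg fun j _ => sq_nonneg _
    have n1 : pd k (fun y => Q₀ y l k) x ^ 2 ≤ ∑ k, ∑ i, ∑ j, pd k (fun y => Q₀ y i j) x ^ 2 :=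
      (le_double_sum (f := fun i j => pd k (fun y => Q₀ y i j) x ^ 2)
        (fun i j => sq_nonneg _) l k).trans
      (Finset.single_le_sum (f := fun k => ∑ i, ∑ j, pd k (fun y => Q₀ y i j) x ^ 2)
        (fun k _ => Finset.sum_nonneg fun i _ => Finset.sum_nonneg fun j _ => sq_nonneg _)
        (Finset.mem_univ k))
    have n2 : pd 0 (pd k fun y => Q₀ y l k) x ^ 2
        ≤ ∑ k, ∑ l, ∑ i, ∑ j, pd k (pd l (fun y => Q₀ y i j)) x ^ 2 :=
      (le_double_sum (f := fun i j => pd 0 (pd k fun y => Q₀ y i j) x ^ 2)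
        (fun i j => sq_nonneg _) l k).trans
      (le_double_sum (f := fun k l => ∑ i, ∑ j, pd k (pd l (fun y => Q₀ y i j)) x ^ 2)
        (fun k l => Finset.sum_nonneg fun i _ => Finset.sum_nonneg fun j _ => sq_nonneg _) 0 k)
    have n3 := sq_nonneg (pd 0 (pd k fun y => Q₀ y l k) x)
    dsimp only
    linarith
  have hQs (s : ℝ) (i j : Fin 2) : ContDiff ℝ (⊤ : ℕ∞) fun y => Q s y i j :=
    contDiff_slice (u := fun s y => Q s y i j) (hQ i j) s
  have hGs (i j : Fin 2) : Continuous fun y => G t y i j :=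
    (contDiff_slice (u := fun s y => G s y i j) (hG i j) t).continuous
  have hQc (s : ℝ) (i j : Fin 2) : Continuous fun y => Q s y i j := (hQs s i j).continuous
  have hQd (s : ℝ) (k i j : Fin 2) : Continuous (pd k fun y => Q s y i j) :=
    ((hQs s i j).pd k (n := 1)).continuous
  have hQdd (k l i j : Fin 2) : Continuous (pd k (pd l fun y => Q t y i j)) :=
    (((hQs t i j).pd l (n := ⊤)).pd k (n := 1)).continuous
  have s0 (s : ℝ) := setIntegral_T2_double_sum (f := fun i j x => Q s x i j ^ 2)
    fun i j => (hQc s i j).pow 2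
  have s1 (s : ℝ) := setIntegral_T2_triple_sum
    (f := fun k i j x => pd k (fun y => Q s y i j) x ^ 2) fun k i j => (hQd s k i j).pow 2
  have s2 := setIntegral_T2_double_sum
    (f := fun i j x => (∑ k, pd k (pd k (fun y => Q t y i j)) x) ^ 2)
    fun i j => by fun_prop
  have s3 := setIntegral_T2_double_sum (f := fun i j x => G t x i j ^ 2)
    fun i j => (hGs i j).pow 2
  simp only [s0, s1, s2, s3]
  have hE (i j : Fin 2) := hasDerivAt_energy (u := fun s y => Q s y i j) (hQ i j)
    (fun s => hQp s i j) t
  have hD := (HasDerivAt.fun_sum (u := Finset.univ) fun i _ =>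
    HasDerivAt.fun_sum (u := Finset.univ) fun j _ => hE i j).const_mul (1 / 2 : ℝ)
  simp only [Finset.sum_add_distrib] at hD
  rw [hD.deriv]
  have key (i j : Fin 2) := scalar_energy_estimate (L := L₄) hζ hc hδ0 hM0 hε2 hδM
    (u := fun y => Q t y i j) (v := fun y => deriv (fun s => Q s y i j) t)
    (g := fun y => G t y i j) (a := fun l k y => Q₀ y l k) (hQs t i j) (hQp t i j)
    (contDiff_slice (u := fun t y => deriv (fun s => Q s y i j) t)
      (contDiff_deriv_joint (u := fun s y => Q s y i j) (hQ i j)) t).continuous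
    (hGs i j) (fun l k => hQ₀ l k) haε haM (fun x => by linarith [heq t x i j])
  have hsum := Finset.sum_le_sum fun i (_ : i ∈ Finset.univ) =>
    Finset.sum_le_sum fun j (_ : j ∈ Finset.univ) => key i j
  simp only [Finset.sum_add_distrib, ← Finset.mul_sum] at hsum ⊢
  linarith
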